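/- Let C be a cycle on at least 4 vertices, let t, u, v, w be consecutive vertices of C (so that tu, uv, vw are edges), and let h be a hatness function with h(v) > h(u). Define a hatness function h' on C ∖ {u,v} by h'(w) = ⌈ h(w) · (1 − 1/⌈h(v)/h(u)⌉) ⌉, h'(t) = h(t) − ⌊h(t)/h(u)⌋, and h'(x) = h(x) for every other vertex x. If ⟨C,h⟩ is winning, then ⟨C ∖ {u,v}, h'⟩ is winning. -/

import Mathlib

/-- The hat guessing game `⟨G, h⟩` is *winning*: there exists a strategy (one
deterministic guessing function per vertex, depending only on the colors of the
neighboring vertices) such that for every assignment of hat colors at least one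
vertex guesses its own color correctly. -/
def HatGame.Winning {V : Type*} (G : SimpleGraph V) (h : V → ℕ) : Prop :=
  ∃ s : ∀ v : V, (∀ u : V, Fin (h u)) → Fin (h v),
    (∀ (v : V) (c c' : ∀ u : V, Fin (h u)),
        (∀ u : V, G.Adj v u → c u = c' u) → s v c = s v c') ∧
    ∀ c : ∀ u : V, Fin (h u), ∃ v : V, s v c = c v

/-- The hat guessing number of `G`: the largest `q` such that the game on `G`
where every vertex has hatness `q` is winning. -/
noncomputable def HatGame.number {V : Type*} (G : SimpleGraph V) : ℕ :=
  sSup {q : ℕ | HatGame.Winning G (fun _ => q)}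

/-- A cactus graph: a connected graph in which every pair of (distinct) cycles
shares at most one vertex. -/
def SimpleGraph.IsCactus {V : Type*} (G : SimpleGraph V) : Prop :=
  G.Connected ∧
    ∀ (v w : V) (c₁ : G.Walk v v) (c₂ : G.Walk w w), c₁.IsCycle → c₂.IsCycle →
      {e | e ∈ c₁.edges} ≠ {e | e ∈ c₂.edges} →
      ({x | x ∈ c₁.support} ∩ {x | x ∈ c₂.support} : Set V).Subsingleton

/-- A winning game stays winning on an induced subgraph with smaller hatnesses, provided the
strategy remains correct when the deleted vertices get the fixed colors `d` and the colors of the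
remaining vertices range over the images of the embeddings `e`. -/
theorem HatGame.winning_induce_of_embedding {V : Type*} {G : SimpleGraph V} {h : V → ℕ}
    (s : ∀ v : V, (∀ u : V, Fin (h u)) → Fin (h v))
    (hs : ∀ (v : V) (c c' : ∀ u : V, Fin (h u)),
      (∀ u : V, G.Adj v u → c u = c' u) → s v c = s v c')
    (S : Set V) (h' : S → ℕ) (d : ∀ v, Fin (h v)) (e : ∀ x : S, Fin (h' x) ↪ Fin (h x))
    (H : ∀ c : ∀ u, Fin (h u), (∀ v, v ∉ S → c v = d v) → (∀ x : S, c x ∈ Set.range (e x)) →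
      ∃ x ∈ S, s x c = c x) :
    HatGame.Winning (G.induce S) h' := by
  classical
  let ext : (∀ x : S, Fin (h' x)) → ∀ v, Fin (h v) := fun c v =>
    if hv : v ∈ S then e ⟨v, hv⟩ (c ⟨v, hv⟩) else d v
  have ext_mem (c : ∀ x : S, Fin (h' x)) (x : S) : ext c x = e x (c x) := by simp [ext]
  refine ⟨fun x c => if hx : ∃ j, e x j = s x (ext c) then hx.choose else ⟨0, (c x).pos⟩,
    fun x c c' hc => ?_, fun c => ?_⟩
  · have : s x (ext c) = s x (ext c') := by
      refine hs _ _ _ fun y hy => ?_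
      by_cases hyS : y ∈ S
      · simp only [ext, hyS, dite_true]
        rw [hc ⟨y, hyS⟩ hy]
      · simp [ext, hyS]
    simp only [this]
  · obtain ⟨x, hxS, hx⟩ := H (ext c) (fun v hv => by simp [ext, hv])
      (fun x => ⟨c x, (ext_mem c x).symm⟩)
    refine ⟨⟨x, hxS⟩, ?_⟩
    have hex : ∃ j, e ⟨x, hxS⟩ j = s x (ext c) := ⟨c ⟨x, hxS⟩, by rw [hx, ← ext_mem]⟩
    simp only [hex, dite_true]
    apply (e ⟨x, hxS⟩).injective
    rw [hex.choose_spec, hx, ← ext_mem]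

/-- Deleting two vertices `u`, `v` whose only neighbors, apart from each other, are `t` and `w`
respectively. -/
theorem HatGame.Winning.delete_two_vertices {V : Type*} {G : SimpleGraph V} {h : V → ℕ}
    (hwin : HatGame.Winning G h) (hpos : ∀ x, 1 ≤ h x) {t u v w : V}
    (htu : t ≠ u) (htv : t ≠ v) (htw : t ≠ w) (huv : u ≠ v) (huw : u ≠ w) (hvw : v ≠ w)
    (hu : ∀ x, G.Adj u x → x = t ∨ x = v) (hv : ∀ x, G.Adj v x → x = u ∨ x = w)
    {k : ℕ} (hk : h u * k < h v) (h' : {x : V | x ≠ u ∧ x ≠ v} → ℕ)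
    (ht' : ∀ x, x.val = t → h' x ≤ h t - h t / h u)
    (hw' : ∀ x, x.val = w → h' x ≤ h w - h w / (k + 1))
    (hle : ∀ x, x.val ≠ t → x.val ≠ w → h' x ≤ h x) :
    HatGame.Winning (G.induce {x : V | x ≠ u ∧ x ≠ v}) h' := by
  classical
  obtain ⟨s, hs, hc⟩ := hwin
  let z : ∀ x, Fin (h x) := fun x => ⟨0, hpos x⟩
  let D : Fin (h u) → Fin (h v) → ∀ x, Fin (h x) := fun a b =>
    Function.update (Function.update z u a) v b
  have D_u (a b) : D a b u = a := by simp [D, huv]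
  have D_v (a b) : D a b v = b := by simp [D]
  have guess_u (a a' b) (c : Fin (h t)) :
      s u (Function.update (D a b) t c) = s u (Function.update (D a' b) t c) := by
    refine hs _ _ _ fun x hx => ?_
    obtain rfl | rfl := hu x hx
    · simp
    · simp [Function.update_of_ne htv.symm, D_v]
  have guess_v (a b b') (c : Fin (h w)) :
      s v (Function.update (D a b) w c) = s v (Function.update (D a b') w c) := by
    refine hs _ _ _ fun x hx => ?_
    obtain rfl | rfl := hv x hx
    · simp [Function.update_of_ne huw, D_u]
    · simp
  have rare_u (b : Fin (h v)) : ∃ a : Fin (h u),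
      (Finset.univ.filter fun c => s u (Function.update (D a b) t c) = a).card
        < h t / h u + 1 := by
    obtain ⟨a, ha⟩ := Fintype.exists_card_fiber_lt_of_card_lt_mul
      (f := fun c : Fin (h t) => s u (Function.update (D (z u) b) t c)) (n := h t / h u + 1)
      (by simpa using Nat.lt_mul_div_succ (h t) (hpos u))
    refine ⟨a, ?_⟩
    simpa only [guess_u a (z u)] using ha
  choose f hf using rare_u
  obtain ⟨a, ha⟩ := Fintype.exists_lt_card_fiber_of_mul_lt_card (f := f) (n := k) (by simpa using hk)
  obtain ⟨b, hbmem, hb⟩ := Finset.exists_card_fiber_lt_of_card_lt_mul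
    (s := (Finset.univ : Finset (Fin (h w)))) (t := Finset.univ.filter fun b => f b = a)
    (f := fun c => s v (Function.update (D a (z v)) w c)) (n := h w / (k + 1) + 1)
    (by
      simp only [Finset.card_univ, Fintype.card_fin]
      exact (Nat.lt_mul_div_succ (h w) k.succ_pos).trans_le (Nat.mul_le_mul_right _ ha))
  obtain rfl : f b = a := by simpa using hbmem
  have hT := hf b
  simp only [guess_v _ (z v) b] at hb
  set d := D (f b) b with hd
  have d_u : d u = f b := D_u _ _
  have d_v : d v = b := D_v _ _
  have embed (x : {x : V | x ≠ u ∧ x ≠ v}) : ∃ e : Fin (h' x) ↪ Fin (h x),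
      ∀ j, (x.val = t → s u (Function.update d x (e j)) ≠ f b) ∧
        (x.val = w → s v (Function.update d x (e j)) ≠ b) := by
    have of_card (A : Finset (Fin (h x))) (hA : h' x ≤ A.card) :
        ∃ e : Fin (h' x) ↪ Fin (h x), ∀ j, e j ∈ A := by
      obtain ⟨e⟩ : Nonempty (Fin (h' x) ↪ A) :=
        Function.Embedding.nonempty_of_card_le (by simpa using hA)
      exact ⟨e.trans (Function.Embedding.subtype _), fun j => (e j).2⟩
    obtain ⟨x, hx⟩ := x
    by_cases hxt : x = t
    · subst hxt
      have := ht' ⟨x, hx⟩ rfl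
      obtain ⟨e, he⟩ := of_card (Finset.univ.filter fun c => s u (Function.update d x c) = f b)ᶜ
        (by rw [Finset.card_compl, Fintype.card_fin]; dsimp only at *; omega)
      exact ⟨e, fun j => ⟨fun _ => by simpa using he j, fun hxw => absurd hxw htw⟩⟩
    by_cases hxw : x = w
    · subst hxw
      have := hw' ⟨x, hx⟩ rfl
      obtain ⟨e, he⟩ := of_card (Finset.univ.filter fun c => s v (Function.update d x c) = b)ᶜ
        (by rw [Finset.card_compl, Fintype.card_fin]; dsimp only at *; omega)
      exact ⟨e, fun j => ⟨fun h => absurd h hxt, fun _ => by simpa using he j⟩⟩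
    · obtain ⟨e, -⟩ := of_card Finset.univ (by simpa using hle ⟨x, hx⟩ hxt hxw)
      exact ⟨e, fun j => ⟨fun h => absurd h hxt, fun h => absurd h hxw⟩⟩
  choose e he using embed
  refine winning_induce_of_embedding s hs _ h' d e fun c hcd hce => ?_
  have c_u : c u = f b := by rw [hcd u (by simp), d_u]
  have c_v : c v = b := by rw [hcd v (by simp), d_v]
  obtain ⟨x, hx⟩ := hc c
  refine ⟨x, ⟨?_, ?_⟩, hx⟩
  · rintro rfl
    obtain ⟨j, hj⟩ := hce ⟨t, htu, htv⟩
    refine (he ⟨t, htu, htv⟩ j).1 rfl ?_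
    rw [hj, ← c_u, ← hx]
    refine hs _ _ _ fun y hy => ?_
    obtain rfl | rfl := hu y hy
    · simp
    · simp [Function.update_of_ne htv.symm, c_v, d_v]
  · rintro rfl
    obtain ⟨j, hj⟩ := hce ⟨w, huw.symm, hvw.symm⟩
    refine (he ⟨w, huw.symm, hvw.symm⟩ j).2 rfl ?_
    rw [hj]
    refine Eq.trans (hs _ _ _ fun y hy => ?_) (hx.trans c_v)
    obtain rfl | rfl := hv y hy
    · simp [Function.update_of_ne huw, c_u, d_u]
    · simp

/-- The deletion lemma: let `C` be a cycle on `n ≥ 4` vertices with consecutive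
vertices `t = i`, `u = i+1`, `v = i+2`, `w = i+3`, and let `h` satisfy
`h v > h u`.  If `⟨C,h⟩` is winning then the game on the path `C ∖ {u,v}` with
the modified hatness function `h'` is winning, where
`h' w = ⌈h w · (1 − 1/⌈h v / h u⌉)⌉`, `h' t = h t − ⌊h t / h u⌋`, and `h'` agrees
with `h` elsewhere. -/
theorem cycle_delete_two_vertices (n : ℕ) [NeZero n] (hn : 4 ≤ n)
    (i : Fin n) (h : Fin n → ℕ) (hh : ∀ x, 1 ≤ h x)
    (huv : h (i + 2) > h (i + 1))
    (hwin : HatGame.Winning (SimpleGraph.cycleGraph n) h) :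
    HatGame.Winning
      ((SimpleGraph.cycleGraph n).induce {x : Fin n | x ≠ i + 1 ∧ x ≠ i + 2})
      (fun x =>
        if x.val = i + 3 then
          ⌈(h (i + 3) : ℚ) * (1 - ((⌈(h (i + 2) : ℚ) / (h (i + 1) : ℚ)⌉ : ℚ))⁻¹)⌉.toNat
        else if x.val = i then
          h i - h i / h (i + 1)
        else h x.val) := by
  obtain ⟨m, rfl⟩ := Nat.exists_eq_add_of_le' hn
  have two : (2 : Fin (m + 4)) = 1 + 1 := by ext; simp [Fin.val_add]
  have three : (3 : Fin (m + 4)) = 1 + 2 := by ext; simp [Fin.val_add]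
  have one_ne : (1 : Fin (m + 4)) ≠ 0 := by simp
  have two_ne : (2 : Fin (m + 4)) ≠ 0 := by
    simp [Fin.ext_iff, Nat.mod_eq_of_lt (show 2 < m + 4 by omega)]
  have three_ne : (3 : Fin (m + 4)) ≠ 0 := by
    simp [Fin.ext_iff, Nat.mod_eq_of_lt (show 3 < m + 4 by omega)]
  have adj {x y : Fin (m + 4)} (hxy : (SimpleGraph.cycleGraph (m + 4)).Adj x y) :
      x - y = 1 ∨ y - x = 1 := SimpleGraph.cycleGraph_adj.mp hxy
  have hposu : (0 : ℚ) < h (i + 1) := by exact_mod_cast hh (i + 1)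
  obtain ⟨k, hk⟩ : ∃ k : ℕ, ⌈(h (i + 2) : ℚ) / (h (i + 1) : ℚ)⌉ = (k : ℤ) + 1 := by
    have : 0 < ⌈(h (i + 2) : ℚ) / (h (i + 1) : ℚ)⌉ :=
      Int.ceil_pos.mpr (div_pos (by exact_mod_cast hh (i + 2)) hposu)
    exact ⟨(⌈(h (i + 2) : ℚ) / (h (i + 1) : ℚ)⌉ - 1).toNat, by omega⟩
  have hk_lt : h (i + 1) * k < h (i + 2) := by
    have : (k : ℚ) < h (i + 2) / h (i + 1) := by
      simpa using Int.lt_ceil.mp (show (k : ℤ) < ⌈(h (i + 2) : ℚ) / (h (i + 1) : ℚ)⌉ by omega)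
    rw [lt_div_iff₀ hposu, mul_comm] at this
    exact_mod_cast this
  have hceil : ⌈(h (i + 3) : ℚ) * (1 - ((⌈(h (i + 2) : ℚ) / (h (i + 1) : ℚ)⌉ : ℚ))⁻¹)⌉.toNat
      ≤ h (i + 3) - h (i + 3) / (k + 1) := by
    rw [Int.toNat_le, Int.ceil_le, hk, Int.cast_natCast, Nat.cast_sub (Nat.div_le_self _ _)]
    have := Nat.cast_div_le (α := ℚ) (m := h (i + 3)) (n := k + 1)
    push_cast at this ⊢
    rw [mul_sub, mul_one, ← div_eq_mul_inv]
    linarith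
  have t_ne_w : i ≠ i + 3 := by simp [three_ne]
  refine hwin.delete_two_vertices hh (t := i) (w := i + 3) (by simp)
    (by simpa using two_ne) t_ne_w ?_ ?_ ?_ ?_ ?_ hk_lt _ ?_ ?_ ?_
  · simp [two]
  · simpa [three] using two_ne
  · intro h23; exact one_ne (by grind)
  · intro x hx; have := adj hx; grind
  · intro x hx; have := adj hx; grind
  · intro x hx
    simp [hx, t_ne_w]
  · intro x hx
    simpa [hx] using hceil
  · intro x hxt hxw
    simp [hxt, hxw]
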